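/- arXiv:math/0512273 — 4 statements merged into one kernel-verified Lean document; each statement's English description precedes it below -/
import Mathlib

section
/- A subbase B_e = {e′_ij : i,j ∈ {1,…,n}} of End A is a base collection if and only if for every collection of endomorphisms α₁,…,αₙ ∈ End A and every subbase B_f = {f′_ij : i,j ∈ {1,…,n}} of End A there exist endomorphisms φ, ψ ∈ End A such that α_i ∘ f′_ii = ψ ∘ e′_ii ∘ φ for all i ∈ {1,…,n}. -/
/-!
Statement 6: A subbase `B_e = {e′_ij}` of `End A` (`A = K⟨x₁,…,xₙ⟩`, `n ≥ 2`) is a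
base collection if and only if for every collection of endomorphisms `α₁,…,αₙ` and
every subbase `B_f = {f′_ij}` there exist endomorphisms `φ, ψ` with
`α_i ∘ f′_ii = ψ ∘ e′_ii ∘ φ` for all `i`.
-/

namespace Stmt6

variable (K : Type*) [Field K] (n : ℕ)

/-- The endomorphism of `A` sending every generator `xᵢ` to `0`. -/
noncomputable def zeroEndo : FreeAlgebra K (Fin n) →ₐ[K] FreeAlgebra K (Fin n) :=
  FreeAlgebra.lift K (fun _ => 0)

/-- `φ` has rank 1: its image is a commutative subalgebra of `A`. -/
def HasRankOne (φ : FreeAlgebra K (Fin n) →ₐ[K] FreeAlgebra K (Fin n)) : Prop :=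
  ∀ a b : FreeAlgebra K (Fin n), φ a * φ b = φ b * φ a

/-- The family `e` with witnesses `z` is a subbase of `End A`:
`e_ij ∘ e_km = δ_jk e_im`, and each `e_ij` has rank 1 with image `K[z_ij]`. -/
def IsSubbase (e : Fin n → Fin n → (FreeAlgebra K (Fin n) →ₐ[K] FreeAlgebra K (Fin n)))
    (z : Fin n → Fin n → FreeAlgebra K (Fin n)) : Prop :=
  (∀ i j k m : Fin n, (e i j).comp (e k m) = if j = k then e i m else zeroEndo K n) ∧
  (∀ i j : Fin n, HasRankOne K n (e i j)) ∧
  (∀ i j : Fin n, (e i j).range = Algebra.adjoin K {z i j})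

/-- A subbase is a base collection if the diagonal witnesses `z_i = z_ii` form a
base of `A`, i.e. the endomorphism `xᵢ ↦ z_i` is an automorphism of `A`. -/
def IsBaseCollection (e : Fin n → Fin n → (FreeAlgebra K (Fin n) →ₐ[K] FreeAlgebra K (Fin n)))
    (z : Fin n → Fin n → FreeAlgebra K (Fin n)) : Prop :=
  IsSubbase K n e z ∧ Function.Bijective (FreeAlgebra.lift K (fun i => z i i))

section Hopfian

variable {K : Type*} [Field K] {X : Type*}

/-- The algebra map `xᵢ ↦ xᵢ T` into polynomials over the free algebra; the coefficient of `T ^ j`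
is the homogeneous component of degree `j`. -/
noncomputable def homogenize : FreeAlgebra K X →ₐ[K] Polynomial (FreeAlgebra K X) :=
  FreeAlgebra.lift K fun i => Polynomial.C (FreeAlgebra.ι K i) * Polynomial.X

/-- The span of the generators of the free algebra. -/
noncomputable def linearPart (K : Type*) [Field K] (X : Type*) : Submodule K (FreeAlgebra K X) :=
  Submodule.span K (Set.range (FreeAlgebra.ι K))

theorem homogenize_ι (i : X) : homogenize (FreeAlgebra.ι K i) =
    Polynomial.C (FreeAlgebra.ι K i) * Polynomial.X :=
  FreeAlgebra.lift_ι_apply _ _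

theorem eval_one_homogenize (a : FreeAlgebra K X) : (homogenize a).eval 1 = a := by
  induction a using FreeAlgebra.induction with
  | grade0 r => simp [Polynomial.algebraMap_apply]
  | grade1 i => simp [homogenize_ι]
  | mul a b ha hb =>
    rw [map_mul]
    have h := (Polynomial.eval₂RingHom' (RingHom.id (FreeAlgebra K X)) 1
      fun a => Commute.one_right a).map_mul (homogenize a) (homogenize b)
    change (homogenize a * homogenize b).eval 1 =
      (homogenize a).eval 1 * (homogenize b).eval 1 at h
    rw [h, ha, hb]
  | add a b ha hb => rw [map_add, Polynomial.eval_add, ha, hb]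

theorem coeff_homogenize_mem (a : FreeAlgebra K X) (j : ℕ) :
    (homogenize a).coeff j ∈ linearPart K X ^ j := by
  induction a using FreeAlgebra.induction generalizing j with
  | grade0 r =>
    rw [AlgHom.commutes, Polynomial.algebraMap_apply, Polynomial.coeff_C]
    split_ifs with h
    · subst h
      rw [pow_zero]
      exact Submodule.algebraMap_mem r
    · exact zero_mem _
  | grade1 i =>
    rw [homogenize_ι, Polynomial.coeff_C_mul, Polynomial.coeff_X]
    split_ifs with h
    · subst h
      rw [pow_one, mul_one]
      exact Submodule.subset_span ⟨i, rfl⟩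
    · rw [mul_zero]
      exact zero_mem _
  | mul a b ha hb =>
    rw [map_mul, Polynomial.coeff_mul]
    refine Submodule.sum_mem _ fun p hp => ?_
    rw [← Finset.HasAntidiagonal.mem_antidiagonal.mp hp, pow_add]
    exact Submodule.mul_mem_mul (ha _) (hb _)
  | add a b ha hb =>
    rw [map_add, Polynomial.coeff_add]
    exact add_mem (ha j) (hb j)

/-- The homogeneous component of degree `j`. -/
noncomputable def component (j : ℕ) :
    FreeAlgebra K X →ₗ[K] ↥(linearPart K X ^ j) where
  toFun a := ⟨(homogenize a).coeff j, coeff_homogenize_mem a j⟩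
  map_add' a b := by ext; simp
  map_smul' r a := by ext; simp

/-- The elements of the free algebra whose homogeneous components of degree less than `k` vanish. -/
noncomputable def orderGE (K : Type*) [Field K] (X : Type*) (k : ℕ) :
    Submodule K (FreeAlgebra K X) :=
  LinearMap.ker (LinearMap.pi fun j : Fin k => component (K := K) (X := X) j)

theorem mem_orderGE {k : ℕ} {a : FreeAlgebra K X} :
    a ∈ orderGE K X k ↔ ∀ j < k, (homogenize a).coeff j = 0 := by
  simp [orderGE, component, funext_iff, Fin.forall_iff]

theorem orderGE_anti {k l : ℕ} (h : k ≤ l) : orderGE K X l ≤ orderGE K X k :=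
  fun _ ha => mem_orderGE.mpr fun j hj => mem_orderGE.mp ha j (hj.trans_le h)

theorem mul_mem_orderGE {k l : ℕ} {a b : FreeAlgebra K X} (ha : a ∈ orderGE K X k)
    (hb : b ∈ orderGE K X l) : a * b ∈ orderGE K X (k + l) := by
  rw [mem_orderGE] at *
  intro j hj
  rw [map_mul, Polynomial.coeff_mul]
  refine Finset.sum_eq_zero fun p hp => ?_
  have hp := Finset.HasAntidiagonal.mem_antidiagonal.mp hp
  rcases lt_or_ge p.1 k with h | h
  · rw [ha _ h, zero_mul]
  · rw [hb _ (by omega), mul_zero]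

theorem linearPart_pow_le_comap_orderGE (ψ : FreeAlgebra K X →ₐ[K] FreeAlgebra K X)
    (hψ : ∀ i, ψ (FreeAlgebra.ι K i) ∈ orderGE K X 1) (j : ℕ) :
    linearPart K X ^ j ≤ (orderGE K X j).comap ψ.toLinearMap := by
  induction j with
  | zero => exact fun a _ => mem_orderGE.mpr fun j hj => absurd hj (Nat.not_lt_zero j)
  | succ j ih =>
    rw [pow_succ, Submodule.mul_le]
    intro a ha b hb
    have hb' : linearPart K X ≤ (orderGE K X 1).comap ψ.toLinearMap := by
      rw [linearPart, Submodule.span_le]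
      rintro _ ⟨i, rfl⟩
      exact hψ i
    rw [Submodule.mem_comap, AlgHom.toLinearMap_apply, map_mul]
    exact mul_mem_orderGE (ih ha) (hb' hb)

theorem orderGE_le_comap (ψ : FreeAlgebra K X →ₐ[K] FreeAlgebra K X)
    (hψ : ∀ i, ψ (FreeAlgebra.ι K i) ∈ orderGE K X 1) (k : ℕ) :
    orderGE K X k ≤ (orderGE K X k).comap ψ.toLinearMap := by
  intro a ha
  rw [← eval_one_homogenize a, Polynomial.eval_eq_sum]
  refine Submodule.sum_mem _ fun j hj => ?_
  simp only [one_pow, mul_one]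
  have hkj : k ≤ j := by
    by_contra! h
    exact Polynomial.mem_support_iff.mp hj (mem_orderGE.mp ha j h)
  exact orderGE_anti hkj (linearPart_pow_le_comap_orderGE ψ hψ j (coeff_homogenize_mem a j))

theorem finite_quotient_orderGE [Finite X] (k : ℕ) :
    Module.Finite K (FreeAlgebra K X ⧸ orderGE K X k) := by
  have hfin (j : ℕ) : Module.Finite K ↥(linearPart K X ^ j) :=
    Module.Finite.iff_fg.mpr ((Submodule.fg_span (Set.finite_range _)).pow j)
  exact Module.Finite.of_injective _ (LinearMap.quotKerEquivRange
    (LinearMap.pi fun j : Fin k => component (K := K) (X := X) j)).injective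

theorem injective_of_surjective_of_mem_orderGE [Finite X]
    {ψ : FreeAlgebra K X →ₐ[K] FreeAlgebra K X}
    (hψ : ∀ i, ψ (FreeAlgebra.ι K i) ∈ orderGE K X 1) (hs : Function.Surjective ψ) :
    Function.Injective ψ := by
  rw [injective_iff_map_eq_zero]
  intro a ha
  have hmem (k : ℕ) : a ∈ orderGE K X k := by
    have := finite_quotient_orderGE (K := K) (X := X) k
    let q := (orderGE K X k).mapQ (orderGE K X k) ψ.toLinearMap (orderGE_le_comap ψ hψ k)
    have hq : Function.Surjective q := by
      intro y
      obtain ⟨b, rfl⟩ := Submodule.Quotient.mk_surjective _ y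
      obtain ⟨c, rfl⟩ := hs b
      exact ⟨Submodule.Quotient.mk c, rfl⟩
    rw [← Submodule.Quotient.mk_eq_zero]
    apply LinearMap.injective_iff_surjective.mpr hq
    rw [map_zero, Submodule.mapQ_apply, AlgHom.toLinearMap_apply, ha, Submodule.Quotient.mk_zero]
  have h0 : homogenize a = 0 :=
    Polynomial.ext fun j => mem_orderGE.mp (hmem (j + 1)) j j.lt_succ_self
  rw [← eval_one_homogenize a, h0, Polynomial.eval_zero]

/-- A free associative algebra of finite rank is Hopfian. -/
theorem injective_of_surjective [Finite X] {ψ : FreeAlgebra K X →ₐ[K] FreeAlgebra K X}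
    (hs : Function.Surjective ψ) : Function.Injective ψ := by
  have hr (i : X) : ∃ r : K, algebraMap K (FreeAlgebra K X) r =
      (homogenize (ψ (FreeAlgebra.ι K i))).coeff 0 := by
    have h := coeff_homogenize_mem (ψ (FreeAlgebra.ι K i)) 0
    rwa [pow_zero, Submodule.mem_one] at h
  choose r hr using hr
  let T : FreeAlgebra K X →ₐ[K] FreeAlgebra K X :=
    FreeAlgebra.lift K fun i => FreeAlgebra.ι K i - algebraMap K _ (r i)
  let T' : FreeAlgebra K X →ₐ[K] FreeAlgebra K X :=
    FreeAlgebra.lift K fun i => FreeAlgebra.ι K i + algebraMap K _ (r i)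
  have hTT' : T.comp T' = AlgHom.id K _ := by ext i; simp [T, T']
  have hT'T : T'.comp T = AlgHom.id K _ := by ext i; simp [T, T']
  have hT (a) : T (T' a) = a := DFunLike.congr_fun hTT' a
  have hT' (a) : T' (T a) = a := DFunLike.congr_fun hT'T a
  have hinj : Function.Injective (ψ.comp T) := by
    refine injective_of_surjective_of_mem_orderGE (fun i => mem_orderGE.mpr fun j hj => ?_) ?_
    · obtain rfl : j = 0 := by omega
      simp [T, ← hr, Polynomial.algebraMap_apply]
    · exact hs.comp fun a => ⟨T' a, hT a⟩
  intro a b hab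
  have h : T' a = T' b := hinj (by simpa [hT] using hab)
  rw [← hT a, h, hT]

end Hopfian

section Subbase

variable {K : Type*} [Field K] {n : ℕ}
  {e : Fin n → Fin n → (FreeAlgebra K (Fin n) →ₐ[K] FreeAlgebra K (Fin n))}
  {z : Fin n → Fin n → FreeAlgebra K (Fin n)}

/-- The augmentation of the free algebra. -/
noncomputable def augmentation (K : Type*) [Field K] (n : ℕ) : FreeAlgebra K (Fin n) →ₐ[K] K :=
  FreeAlgebra.lift K fun _ => 0

theorem zeroEndo_apply (a : FreeAlgebra K (Fin n)) :
    zeroEndo K n a = algebraMap K _ (augmentation K n a) := by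
  have h : zeroEndo K n = (Algebra.ofId K _).comp (augmentation K n) := by
    ext i
    simp [zeroEndo, augmentation]
  exact DFunLike.congr_fun h a

theorem IsSubbase.apply_witness_self (he : IsSubbase K n e z) (i : Fin n) :
    e i i (z i i) = z i i := by
  obtain ⟨a, ha⟩ : z i i ∈ (e i i).range := by
    rw [he.2.2 i i]
    exact Algebra.self_mem_adjoin_singleton K _
  have h := he.1 i i i i
  rw [if_pos rfl] at h
  have h := DFunLike.congr_fun h a
  change e i i a = z i i at ha
  rwa [AlgHom.comp_apply, ha] at h

theorem IsSubbase.apply_witness_of_ne (he : IsSubbase K n e z) {i j : Fin n} (hij : i ≠ j) :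
    e i i (z j j) = algebraMap K _ (augmentation K n (z j j)) := by
  have h := he.1 i i j j
  rw [if_neg hij] at h
  have h := DFunLike.congr_fun h (z j j)
  rwa [AlgHom.comp_apply, he.apply_witness_self, zeroEndo_apply] at h

theorem IsSubbase.exists_aeval_eq (he : IsSubbase K n e z) (i : Fin n)
    (a : FreeAlgebra K (Fin n)) : ∃ p : Polynomial K, Polynomial.aeval (z i i) p = e i i a := by
  have h : e i i a ∈ Algebra.adjoin K {z i i} := he.2.2 i i ▸ ⟨a, rfl⟩
  rwa [Algebra.adjoin_singleton_eq_range_aeval] at h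

theorem IsSubbase.augmentation_apply (hn : 2 ≤ n) (he : IsSubbase K n e z) (i : Fin n)
    (a : FreeAlgebra K (Fin n)) : augmentation K n (e i i a) = augmentation K n a := by
  have : Nontrivial (Fin n) := Fin.nontrivial_iff_two_le.mpr hn
  obtain ⟨j, hj⟩ := exists_ne i
  have hji := he.1 j j i i
  rw [if_neg hj] at hji
  have hii := he.1 i i i i
  rw [if_pos rfl] at hii
  apply FaithfulSMul.algebraMap_injective K (FreeAlgebra K (Fin n))
  rw [← zeroEndo_apply, ← zeroEndo_apply, ← hji, AlgHom.comp_apply, AlgHom.comp_apply,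
    ← AlgHom.comp_apply (e i i), hii]

/-- The polynomial `p` expresses `e i i a` in a witness translated to have augmentation `c`. -/
theorem IsSubbase.exists_aeval_translate_eq (hn : 2 ≤ n) (he : IsSubbase K n e z) (i : Fin n)
    (c : K) (a : FreeAlgebra K (Fin n)) : ∃ p : Polynomial K,
      Polynomial.aeval (z i i + algebraMap K _ (c - augmentation K n (z i i))) p = e i i a ∧
      p.eval c = augmentation K n a := by
  obtain ⟨p, hp⟩ := he.exists_aeval_eq i a
  refine ⟨p.comp (Polynomial.X - Polynomial.C (c - augmentation K n (z i i))), ?_, ?_⟩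
  · rw [Polynomial.aeval_comp, ← hp]
    simp
  · rw [← he.augmentation_apply hn i a, ← hp, ← Polynomial.aeval_algHom_apply]
    simp [Polynomial.eval_comp, Polynomial.coe_aeval_eq_eval]

theorem IsBaseCollection.exists_factorization (hn : 2 ≤ n) (he : IsBaseCollection K n e z)
    (α : Fin n → (FreeAlgebra K (Fin n) →ₐ[K] FreeAlgebra K (Fin n)))
    {f : Fin n → Fin n → (FreeAlgebra K (Fin n) →ₐ[K] FreeAlgebra K (Fin n))}
    {w : Fin n → Fin n → FreeAlgebra K (Fin n)} (hf : IsSubbase K n f w) :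
    ∃ φ ψ : FreeAlgebra K (Fin n) →ₐ[K] FreeAlgebra K (Fin n),
      ∀ i : Fin n, (α i).comp (f i i) = ψ.comp ((e i i).comp φ) := by
  obtain ⟨he, hz⟩ := he
  let c (i : Fin n) : K := augmentation K n (z i i)
  choose p hp hpc using fun i k : Fin n =>
    hf.exists_aeval_translate_eq hn i (c i) (FreeAlgebra.ι K k)
  let w' (i : Fin n) := w i i + algebraMap K _ (c i - augmentation K n (w i i))
  let ζ := AlgEquiv.ofBijective _ hz
  let ψ : FreeAlgebra K (Fin n) →ₐ[K] FreeAlgebra K (Fin n) :=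
    (FreeAlgebra.lift K fun i => α i (w' i)).comp ζ.symm.toAlgHom
  have hψ (i : Fin n) : ψ (z i i) = α i (w' i) := by
    have h : ζ (FreeAlgebra.ι K i) = z i i := FreeAlgebra.lift_ι_apply _ _
    have h' : ζ.symm (z i i) = FreeAlgebra.ι K i := by rw [← h, AlgEquiv.symm_apply_apply]
    change FreeAlgebra.lift K _ (ζ.symm (z i i)) = _
    rw [h', FreeAlgebra.lift_ι_apply]
  refine ⟨FreeAlgebra.lift K fun k => ∑ i, Polynomial.aeval (z i i) (p i k), ψ, fun i => ?_⟩
  ext k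
  have hφ : e i i (∑ j, Polynomial.aeval (z j j) (p j k)) = Polynomial.aeval (z i i) (p i k) := by
    rw [map_sum, Finset.sum_eq_single i]
    · rw [← Polynomial.aeval_algHom_apply, he.apply_witness_self]
    · intro j _ hj
      rw [← Polynomial.aeval_algHom_apply, he.apply_witness_of_ne hj.symm,
        Polynomial.aeval_algebraMap_apply, Polynomial.coe_aeval_eq_eval, hpc]
      simp [augmentation]
    · simp
  simp only [Function.comp_apply, AlgHom.comp_apply, FreeAlgebra.lift_ι_apply]
  rw [hφ, ← hp, ← Polynomial.aeval_algHom_apply, ← Polynomial.aeval_algHom_apply, hψ]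

/-- The standard subbase, consisting of the endomorphisms `xⱼ ↦ xᵢ`, `xₖ ↦ 0` for `k ≠ j`. -/
noncomputable def matrixUnit (K : Type*) [Field K] (n : ℕ) (i j : Fin n) :
    FreeAlgebra K (Fin n) →ₐ[K] FreeAlgebra K (Fin n) :=
  FreeAlgebra.lift K fun k => if k = j then FreeAlgebra.ι K i else 0

theorem range_matrixUnit (i j : Fin n) :
    (matrixUnit K n i j).range = Algebra.adjoin K {FreeAlgebra.ι K i} := by
  apply le_antisymm
  · rw [matrixUnit, ← Algebra.adjoin_range_eq_range_freeAlgebra_lift, Algebra.adjoin_le_iff]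
    rintro _ ⟨k, rfl⟩
    dsimp only
    split_ifs
    · exact Algebra.self_mem_adjoin_singleton K _
    · exact zero_mem _
  · rw [Algebra.adjoin_le_iff, Set.singleton_subset_iff]
    exact ⟨FreeAlgebra.ι K j, by simp [matrixUnit]⟩

theorem isSubbase_matrixUnit :
    IsSubbase K n (matrixUnit K n) fun i _ => FreeAlgebra.ι K i := by
  refine ⟨fun i j k m => ?_, fun i j a b => ?_, range_matrixUnit⟩
  · ext l
    simp only [matrixUnit, zeroEndo, Function.comp_apply, AlgHom.comp_apply,
      FreeAlgebra.lift_ι_apply]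
    split_ifs with hl hjk hjk <;> simp_all [eq_comm]
  · have h (a) : ∃ p : Polynomial K, Polynomial.aeval (FreeAlgebra.ι K i) p =
        matrixUnit K n i j a := by
      have ha : matrixUnit K n i j a ∈ Algebra.adjoin K {FreeAlgebra.ι K i} :=
        range_matrixUnit (K := K) i j ▸ ⟨a, rfl⟩
      rwa [Algebra.adjoin_singleton_eq_range_aeval] at ha
    obtain ⟨p, hp⟩ := h a
    obtain ⟨q, hq⟩ := h b
    rw [← hp, ← hq, ← map_mul, ← map_mul, mul_comm]

theorem IsSubbase.isBaseCollection_of_factorization (he : IsSubbase K n e z)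
    {φ ψ : FreeAlgebra K (Fin n) →ₐ[K] FreeAlgebra K (Fin n)}
    (h : ∀ i, matrixUnit K n i i = ψ.comp ((e i i).comp φ)) : IsBaseCollection K n e z := by
  refine ⟨he, ?_⟩
  choose p hp using fun i => he.exists_aeval_eq i (φ (FreeAlgebra.ι K i))
  let ζ : FreeAlgebra K (Fin n) →ₐ[K] FreeAlgebra K (Fin n) := FreeAlgebra.lift K fun i => z i i
  let π : FreeAlgebra K (Fin n) →ₐ[K] FreeAlgebra K (Fin n) :=
    FreeAlgebra.lift K fun i => Polynomial.aeval (FreeAlgebra.ι K i) (p i)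
  have hcomp : ψ.comp (ζ.comp π) = AlgHom.id K _ := by
    ext i
    have hi := DFunLike.congr_fun (h i) (FreeAlgebra.ι K i)
    simp only [matrixUnit, FreeAlgebra.lift_ι_apply, if_true, AlgHom.comp_apply, ← hp] at hi
    simp only [Function.comp_apply, AlgHom.comp_apply, AlgHom.id_apply, π,
      FreeAlgebra.lift_ι_apply, ← Polynomial.aeval_algHom_apply ζ]
    simpa [ζ] using hi.symm
  have hψ (a) : ψ (ζ (π a)) = a := DFunLike.congr_fun hcomp a
  have hψi : Function.Injective ψ := injective_of_surjective fun a => ⟨_, hψ a⟩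
  have hζ : Function.Surjective ζ := fun a => ⟨π (ψ a), hψi (hψ (ψ a))⟩
  exact ⟨injective_of_surjective hζ, hζ⟩

end Subbase

theorem baseCollection_iff (hn : 2 ≤ n)
    (e : Fin n → Fin n → (FreeAlgebra K (Fin n) →ₐ[K] FreeAlgebra K (Fin n)))
    (z : Fin n → Fin n → FreeAlgebra K (Fin n)) (he : IsSubbase K n e z) :
    IsBaseCollection K n e z ↔
      ∀ (α : Fin n → (FreeAlgebra K (Fin n) →ₐ[K] FreeAlgebra K (Fin n)))
        (f : Fin n → Fin n → (FreeAlgebra K (Fin n) →ₐ[K] FreeAlgebra K (Fin n)))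
        (w : Fin n → Fin n → FreeAlgebra K (Fin n)), IsSubbase K n f w →
          ∃ φ ψ : FreeAlgebra K (Fin n) →ₐ[K] FreeAlgebra K (Fin n),
            ∀ i : Fin n, (α i).comp (f i i) = ψ.comp ((e i i).comp φ) := by
  refine ⟨fun h α f w hf => h.exists_factorization hn α hf, fun h => ?_⟩
  obtain ⟨φ, ψ, hφψ⟩ := h (fun _ => AlgHom.id K _) _ _ isSubbase_matrixUnit
  exact he.isBaseCollection_of_factorization hφψ

end Stmt6
end

section
/- Let B_e = {e′_ij : i,j ∈ {1,…,n}} be a base collection of endomorphisms of A. Then there exists a base S = (s₁,…,sₙ) of A such that the endomorphisms of B_e are the standard endomorphisms in S, i.e., e′_ij(s_k) = δ_jk s_i for all i,j,k. -/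
/-!
Statement 8: If `B_e = {e′_ij}` is a base collection of endomorphisms of
`A = K⟨x₁,…,xₙ⟩` (`n ≥ 2`), then there is a base `S = (s₁,…,sₙ)` of `A` such that the
endomorphisms of `B_e` are the standard endomorphisms in `S`: `e′_ij (s_k) = δ_jk s_i`.
-/

namespace Stmt8

variable (K : Type*) [Field K] (n : ℕ)

/-- The endomorphism of `A` sending every generator `xᵢ` to `0`. -/
noncomputable def zeroEndo : FreeAlgebra K (Fin n) →ₐ[K] FreeAlgebra K (Fin n) :=
  FreeAlgebra.lift K (fun _ => 0)

/-- `φ` has rank 1: its image is a commutative subalgebra of `A`. -/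
def HasRankOne (φ : FreeAlgebra K (Fin n) →ₐ[K] FreeAlgebra K (Fin n)) : Prop :=
  ∀ a b : FreeAlgebra K (Fin n), φ a * φ b = φ b * φ a

/-- The family `e` with witnesses `z` is a subbase of `End A`:
`e_ij ∘ e_km = δ_jk e_im`, and each `e_ij` has rank 1 with image `K[z_ij]`. -/
def IsSubbase (e : Fin n → Fin n → (FreeAlgebra K (Fin n) →ₐ[K] FreeAlgebra K (Fin n)))
    (z : Fin n → Fin n → FreeAlgebra K (Fin n)) : Prop :=
  (∀ i j k m : Fin n, (e i j).comp (e k m) = if j = k then e i m else zeroEndo K n) ∧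
  (∀ i j : Fin n, HasRankOne K n (e i j)) ∧
  (∀ i j : Fin n, (e i j).range = Algebra.adjoin K {z i j})

/-- A subbase is a base collection if the diagonal witnesses `z_i = z_ii` form a
base of `A`, i.e. the endomorphism `xᵢ ↦ z_i` is an automorphism of `A`. -/
def IsBaseCollection (e : Fin n → Fin n → (FreeAlgebra K (Fin n) →ₐ[K] FreeAlgebra K (Fin n)))
    (z : Fin n → Fin n → FreeAlgebra K (Fin n)) : Prop :=
  IsSubbase K n e z ∧ Function.Bijective (FreeAlgebra.lift K (fun i => z i i))

variable {K n}

/-- The endomorphism `zeroEndo` annihilates `a - ε(a)`, where `ε` is the augmentation. -/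
lemma zeroEndo_sub_algebraMap (a : FreeAlgebra K (Fin n)) :
    zeroEndo K n (a - algebraMap K _ (FreeAlgebra.algebraMapInv a)) = 0 := by
  have h : zeroEndo K n = (Algebra.ofId K _).comp FreeAlgebra.algebraMapInv := by
    ext i
    simp [zeroEndo, FreeAlgebra.algebraMapInv]
  rw [map_sub, AlgHom.commutes, h]
  simp [Algebra.ofId_apply]

/-- An affine change of each member turns a base of the free algebra into a base. -/
lemma bijective_lift_affine {z s : Fin n → FreeAlgebra K (Fin n)}
    (hz : Function.Bijective (FreeAlgebra.lift K z)) (c b : Fin n → K) (hc : ∀ i, c i ≠ 0)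
    (hs : ∀ i, s i = c i • z i + algebraMap K _ (b i)) :
    Function.Bijective (FreeAlgebra.lift K s) := by
  let f : FreeAlgebra K (Fin n) →ₐ[K] FreeAlgebra K (Fin n) :=
    FreeAlgebra.lift K fun i => c i • FreeAlgebra.ι K i + algebraMap K _ (b i)
  let g : FreeAlgebra K (Fin n) →ₐ[K] FreeAlgebra K (Fin n) :=
    FreeAlgebra.lift K fun i => (c i)⁻¹ • (FreeAlgebra.ι K i - algebraMap K _ (b i))
  have hfg : f.comp g = AlgHom.id K _ := by
    ext i
    simp [f, g, hc i]
  have hgf : g.comp f = AlgHom.id K _ := by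
    ext i
    simp [f, g, hc i]
  have hf : Function.Bijective f :=
    Function.bijective_iff_has_inverse.2
      ⟨g, fun a => DFunLike.congr_fun hgf a, fun a => DFunLike.congr_fun hfg a⟩
  have hsf : FreeAlgebra.lift K s = (FreeAlgebra.lift K z).comp f := by
    ext i
    simp [f, hs i]
  rw [hsf, AlgHom.coe_comp]
  exact hz.comp hf

/-- The members of a base of the free algebra are transcendental. -/
lemma injective_aeval_of_injective_lift {z : Fin n → FreeAlgebra K (Fin n)}
    (hz : Function.Injective (FreeAlgebra.lift K z)) (i : Fin n) :
    Function.Injective (Polynomial.aeval (R := K) (z i)) := by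
  have h : Polynomial.aeval (R := K) (z i) =
      (FreeAlgebra.lift K z).comp (Polynomial.aeval (FreeAlgebra.ι K i)) := by
    ext
    simp
  have h' : (FreeAlgebra.lift K fun _ : Fin n => (Polynomial.X : Polynomial K)).comp
      (Polynomial.aeval (FreeAlgebra.ι K i)) = AlgHom.id K _ := by
    ext
    simp
  rw [h, AlgHom.coe_comp]
  exact hz.comp (Function.LeftInverse.injective fun p => DFunLike.congr_fun h' p)

/-- A left compositional factor of a linear polynomial is linear. -/
lemma exists_eq_C_mul_X_add_C_of_comp {p q : Polynomial K} {d : K}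
    (h : p.comp q = Polynomial.X - Polynomial.C d) :
    ∃ c b : K, c ≠ 0 ∧ p = Polynomial.C c * Polynomial.X + Polynomial.C b := by
  have hdeg : p.natDegree * q.natDegree = 1 := by
    rw [← Polynomial.natDegree_comp, h, Polynomial.natDegree_X_sub_C]
  have hp : p.natDegree = 1 := Nat.eq_one_of_mul_eq_one_right hdeg
  obtain ⟨c, hc, b, rfl⟩ := Polynomial.natDegree_eq_one.1 hp
  exact ⟨c, b, hc, rfl⟩

variable (K n)

theorem baseCollection_standard_in_some_base (hn : 2 ≤ n)
    (e : Fin n → Fin n → (FreeAlgebra K (Fin n) →ₐ[K] FreeAlgebra K (Fin n)))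
    (z : Fin n → Fin n → FreeAlgebra K (Fin n)) (he : IsBaseCollection K n e z) :
    ∃ s : Fin n → FreeAlgebra K (Fin n), Function.Bijective (FreeAlgebra.lift K s) ∧
      ∀ i j k : Fin n, e i j (s k) = if j = k then s i else 0 := by
  obtain ⟨⟨hcomp, -, hrange⟩, hz⟩ := he
  have hmul (i j m : Fin n) (a) : e i j (e j m a) = e i m a := by
    rw [← AlgHom.comp_apply, hcomp, if_pos rfl]
  have hpoly (i j : Fin n) (a) : ∃ p : Polynomial K, Polynomial.aeval (z i i) p = e i j a := by
    have : e i j a ∈ (e i i).range := ⟨e i j a, hmul i i j a⟩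
    rwa [hrange, Algebra.adjoin_singleton_eq_range_aeval] at this
  have hfix (i : Fin n) : e i i (z i i) = z i i := by
    have : z i i ∈ (e i i).range := hrange i i ▸ Algebra.self_mem_adjoin_singleton K (z i i)
    obtain ⟨a, ha⟩ := this
    rw [← ha]
    exact hmul i i i a
  let o : Fin n := ⟨0, by omega⟩
  let d : K := FreeAlgebra.algebraMapInv (z o o)
  let w : FreeAlgebra K (Fin n) := z o o - algebraMap K _ d
  have hlin (i : Fin n) : ∃ c b : K, c ≠ 0 ∧ e i o w = c • z i i + algebraMap K _ b := by
    obtain ⟨p, hp⟩ := hpoly i o w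
    obtain ⟨q, hq⟩ := hpoly o i (z i i)
    have hpq : p.comp q = Polynomial.X - Polynomial.C d := by
      apply injective_aeval_of_injective_lift hz.injective o
      rw [Polynomial.aeval_comp, hq, Polynomial.aeval_algHom_apply, hp, hmul]
      simp [w, hfix]
    obtain ⟨c, b, hc, rfl⟩ := exists_eq_C_mul_X_add_C_of_comp hpq
    exact ⟨c, b, hc, by simp [← hp, Algebra.smul_def]⟩
  choose c b hc hs using hlin
  refine ⟨fun i => e i o w, bijective_lift_affine hz c b hc hs, fun i j k => ?_⟩
  rw [← AlgHom.comp_apply, hcomp]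
  split_ifs
  · rfl
  · exact zeroEndo_sub_algebraMap (z o o)

end Stmt8
end

section
/- Let u, v ∈ A with uv ≠ vu, and let R = Algebra.adjoin K {u, v} be the subalgebra of A generated by u and v. Then R satisfies no nontrivial polynomial identity: for every non-zero element P of the free associative algebra K⟨y₁,…,y_m⟩ there exist elements r₁,…,r_m ∈ R such that P(r₁,…,r_m) ≠ 0 (where P(r₁,…,r_m) denotes the image of P under the algebra homomorphism sending y_i ↦ r_i). -/
/-!
Statement 10: Let `u, v ∈ A = K⟨x₁,…,xₙ⟩` (`n ≥ 2`) with `uv ≠ vu`, and let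
`R = Algebra.adjoin K {u, v}`. Then `R` satisfies no nontrivial polynomial identity:
for every nonzero `P ∈ K⟨y₁,…,y_m⟩` (`m ≥ 1`) there exist `r₁,…,r_m ∈ R` with
`P(r₁,…,r_m) ≠ 0`.
-/

namespace Stmt10

section Words

/-- The length-lexicographic order on words. -/
noncomputable instance shortlexOrder {α : Type*} [LinearOrder α] : LinearOrder (FreeMonoid α) :=
  LinearOrder.lift' (fun w => (toLex (w.length, w.toList) : ℕ ×ₗ List α)) fun a b h => by
    simpa using congrArg (fun z => (ofLex z).2) h

variable {α : Type*} [LinearOrder α]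

theorem lt_iff_length_lt_or {p q : FreeMonoid α} :
    p < q ↔ p.length < q.length ∨ p.length = q.length ∧ p.toList < q.toList :=
  Prod.Lex.lt_iff

theorem length_le_of_le {p q : FreeMonoid α} (h : p ≤ q) : p.length ≤ q.length := by
  rcases h.eq_or_lt with rfl | h
  · exact le_rfl
  · rcases lt_iff_length_lt_or.1 h with h | h
    exacts [h.le, h.1.le]

instance : MulLeftStrictMono (FreeMonoid α) where
  elim r p q (h : p < q) := by
    change r * p < r * q
    rw [lt_iff_length_lt_or] at h ⊢
    simp only [FreeMonoid.length_mul, FreeMonoid.toList_mul]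
    rcases h with h | ⟨h, h'⟩
    · left; lia
    · exact .inr ⟨by lia, List.append_left_lt h'⟩

theorem _root_.List.append_lt_append_of_length_eq :
    ∀ {s t : List α} (_ : s.length = t.length) (_ : s < t) (r : List α), s ++ r < t ++ r
  | [], [], _, h, _ => absurd h (lt_irrefl _)
  | a :: s, b :: t, hl, h, r => by
    simp only [List.cons_append, List.cons_lt_cons_iff] at h ⊢
    exact h.imp_right fun h => ⟨h.1, append_lt_append_of_length_eq (by simpa using hl) h.2 r⟩

instance : MulRightStrictMono (FreeMonoid α) where
  elim r p q (h : p < q) := by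
    change p * r < q * r
    rw [lt_iff_length_lt_or] at h ⊢
    simp only [FreeMonoid.length_mul, FreeMonoid.toList_mul]
    rcases h with h | ⟨h, h'⟩
    · left; lia
    · exact .inr ⟨by lia, List.append_lt_append_of_length_eq h h' _⟩

theorem eq_of_mul_eq_mul {α : Type*} {p q r s : FreeMonoid α} (h : p * r = q * s)
    (hl : p.length = q.length) : p = q :=
  (List.append_inj h hl).1

theorem length_pow {α : Type*} (p : FreeMonoid α) (k : ℕ) : (p ^ k).length = k * p.length := by
  induction k with
  | zero => simp
  | succ k ih => rw [pow_succ, FreeMonoid.length_mul, ih]; ring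

end Words

section Leading

open MonoidAlgebra

variable {K M : Type*} [Field K] [LinearOrder M]

/-- Every word in the support of `f` is at most `p`. -/
def IsBound (f : MonoidAlgebra K M) (p : M) : Prop := ∀ q, f.coeff q ≠ 0 → q ≤ p

/-- The word `p` is the largest one in the support of `f`. -/
def IsLead (f : MonoidAlgebra K M) (p : M) : Prop := f.coeff p ≠ 0 ∧ IsBound f p

theorem exists_isLead {f : MonoidAlgebra K M} (hf : f ≠ 0) : ∃ p, IsLead f p := by
  have h : f.coeff.support.Nonempty := by simpa [Finsupp.support_nonempty_iff] using hf
  exact ⟨f.coeff.support.max' h, by simpa using Finset.max'_mem _ h,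
    fun q hq => Finset.le_max' _ _ (by simpa using hq)⟩

theorem IsLead.unique {f : MonoidAlgebra K M} {p q : M} (hp : IsLead f p) (hq : IsLead f q) :
    p = q :=
  le_antisymm (hq.2 _ hp.1) (hp.2 _ hq.1)

theorem IsBound.sub {f g : MonoidAlgebra K M} {p : M} (hf : IsBound f p) (hg : IsBound g p) :
    IsBound (f - g) p := by
  intro q hq
  by_contra h
  have h1 : f.coeff q = 0 := by_contra fun h' => h (hf q h')
  have h2 : g.coeff q = 0 := by_contra fun h' => h (hg q h')
  simp [h1, h2] at hq

theorem IsBound.add {f g : MonoidAlgebra K M} {p : M} (hf : IsBound f p) (hg : IsBound g p) :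
    IsBound (f + g) p := by
  intro q hq
  by_contra h
  have h1 : f.coeff q = 0 := by_contra fun h' => h (hf q h')
  have h2 : g.coeff q = 0 := by_contra fun h' => h (hg q h')
  simp [h1, h2] at hq

theorem IsBound.smul {f : MonoidAlgebra K M} {p : M} (hf : IsBound f p) (c : K) :
    IsBound (c • f) p := fun q hq => hf q fun h => hq (by simp [h])

/-- Subtracting the multiple that cancels the leading term lowers the leading word. -/
theorem IsLead.lt_of_cancel {f g : MonoidAlgebra K M} {p q : M} (hf : IsLead f p)
    (hg : IsLead g p) (hq : IsLead (f - (f.coeff p / g.coeff p) • g) q) : q < p := by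
  refine lt_of_le_of_ne ((hf.2.sub (hg.2.smul _)) _ hq.1) ?_
  rintro rfl
  refine hq.1 ?_
  simp [hg.1]

theorem isBound_one [Monoid M] : IsBound (1 : MonoidAlgebra K M) 1 := by
  intro q hq
  by_contra h
  exact hq (by simp [one_def, (ne_of_not_ge h).symm])

variable [Monoid M] [MulLeftStrictMono M] [MulRightStrictMono M]

theorem IsBound.mul {f g : MonoidAlgebra K M} {p q : M} (hf : IsBound f p) (hg : IsBound g q) :
    IsBound (f * g) (p * q) := by
  classical
  intro r hr
  have := support_coeff_mul_subset f g (Finsupp.mem_support_iff.2 hr)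
  obtain ⟨s, hs, t, ht, rfl⟩ := Finset.mem_mul.1 this
  have := mulLeftMono_of_mulLeftStrictMono M
  have := mulRightMono_of_mulRightStrictMono M
  exact mul_le_mul' (hf _ (by simpa using hs)) (hg _ (by simpa using ht))

theorem IsBound.coeff_mul {f g : MonoidAlgebra K M} {p q : M} (hf : IsBound f p)
    (hg : IsBound g q) : (f * g).coeff (p * q) = f.coeff p * g.coeff q := by
  refine coeff_mul_mul_of_uniqueMul fun s t hs ht h => ?_
  have hs := hf s (by simpa using hs)
  have ht := hg t (by simpa using ht)
  rcases hs.eq_or_lt with rfl | hs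
  · rcases ht.eq_or_lt with rfl | ht
    · exact ⟨rfl, rfl⟩
    · exact absurd h (mul_lt_mul_right ht s).ne
  · have := mulLeftMono_of_mulLeftStrictMono M
    exact absurd h (mul_lt_mul_of_lt_of_le hs ht).ne

theorem IsLead.mul {f g : MonoidAlgebra K M} {p q : M} (hf : IsLead f p) (hg : IsLead g q) :
    IsLead (f * g) (p * q) :=
  ⟨hf.2.coeff_mul hg.2 ▸ mul_ne_zero hf.1 hg.1, hf.2.mul hg.2⟩

theorem IsLead.pow {f : MonoidAlgebra K M} {p : M} (hf : IsLead f p) (k : ℕ) :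
    IsLead (f ^ k) (p ^ k) := by
  induction k with
  | zero => simpa using ⟨by simp, isBound_one⟩
  | succ k ih => simpa only [pow_succ] using ih.mul hf

theorem isBound_commutator_pow {a f : MonoidAlgebra K M} {p q : M} (hf : IsBound f p)
    (hd : IsBound (a * f - f * a) q) (hpq : p * q = q * p) (k : ℕ) :
    IsBound (a * f ^ (k + 1) - f ^ (k + 1) * a) (p ^ k * q) ∧
      (a * f ^ (k + 1) - f ^ (k + 1) * a).coeff (p ^ k * q) =
        (k + 1 : ℕ) * (f.coeff p ^ k * (a * f - f * a).coeff q) := by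
  have hpow : ∀ k, IsBound (f ^ k) (p ^ k) ∧ (f ^ k).coeff (p ^ k) = f.coeff p ^ k := by
    intro k
    induction k with
    | zero => simpa using isBound_one
    | succ k ih =>
      simp only [pow_succ]
      exact ⟨ih.1.mul hf, by rw [ih.1.coeff_mul hf, ih.2]⟩
  induction k with
  | zero => simpa using hd
  | succ k ih =>
    have e : a * f ^ (k + 1 + 1) - f ^ (k + 1 + 1) * a =
        (a * f ^ (k + 1) - f ^ (k + 1) * a) * f + f ^ (k + 1) * (a * f - f * a) := by
      simp only [pow_succ]; noncomm_ring
    have e' : p ^ k * q * p = p ^ (k + 1) * q := by rw [mul_assoc, ← hpq, ← mul_assoc, pow_succ]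
    have h1 := ih.1.mul hf
    have h2 := ih.1.coeff_mul hf
    rw [e'] at h1 h2
    refine ⟨e ▸ h1.add ((hpow (k + 1)).1.mul hd), ?_⟩
    rw [e, coeff_add, Finsupp.add_apply, h2, (hpow (k + 1)).1.coeff_mul hd, ih.2, (hpow _).2]
    push_cast
    ring

end Leading

section Independent

/-- Two elements are right linearly independent. -/
def RightIndependent {B : Type*} [Ring B] (a b : B) : Prop :=
  ∀ x y : B, a * x + b * y = 0 → x = 0 ∧ y = 0

theorem RightIndependent.pow_mul {B : Type*} [Ring B] {a b : B} (h : RightIndependent a b) (m : ℕ)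
    (g : Fin m → B) (x : B) (hg : b ^ m * x + ∑ i : Fin m, b ^ (i : ℕ) * a * g i = 0) :
    x = 0 ∧ ∀ i, g i = 0 := by
  induction m generalizing x with
  | zero => simpa using hg
  | succ m ih =>
    have e : a * g 0 + b * (b ^ m * x + ∑ i : Fin m, b ^ (i : ℕ) * a * g i.succ) = 0 := by
      rw [← hg, Fin.sum_univ_succ, mul_add, Finset.mul_sum]
      simp only [Fin.val_zero, Fin.val_succ, pow_succ', mul_assoc, pow_zero, one_mul]
      abel
    obtain ⟨h0, h1⟩ := h _ _ e
    obtain ⟨h2, h3⟩ := ih _ _ h1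
    exact ⟨h2, Fin.cases h0 h3⟩

theorem exists_eq_algebraMap_add_sum {K : Type*} [CommRing K] {m : ℕ}
    (P : FreeAlgebra K (Fin m)) : ∃ (c : K) (Q : Fin m → FreeAlgebra K (Fin m)),
      P = algebraMap K _ c + ∑ i, FreeAlgebra.ι K i * Q i := by
  induction P using FreeAlgebra.induction with
  | grade0 r => exact ⟨r, 0, by simp⟩
  | grade1 x => exact ⟨0, Pi.single x 1, by simp [Pi.single_apply]⟩
  | mul P P' h h' =>
    obtain ⟨c, Q, hP⟩ := h
    obtain ⟨c', Q', hP'⟩ := h'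
    refine ⟨c * c', fun i => c • Q' i + Q i * P', ?_⟩
    nth_rw 1 [hP]
    rw [add_mul, Finset.sum_mul, ← Algebra.smul_def, hP', smul_add, ← hP', Finset.smul_sum]
    simp [mul_add, Finset.sum_add_distrib, mul_assoc, Algebra.smul_def, add_assoc, Algebra.left_comm]
  | add P P' h h' =>
    obtain ⟨c, Q, hP⟩ := h
    obtain ⟨c', Q', hP'⟩ := h'
    refine ⟨c + c', fun i => Q i + Q' i, ?_⟩
    rw [hP, hP']
    simp only [map_add, mul_add, Finset.sum_add_distrib]
    abel

/-- A family which, together with a further element, is right linearly independent, freely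
generates a free algebra. -/
theorem lift_injective_of_rightIndependent {K B : Type*} [Field K] [Ring B] [Nontrivial B]
    [Algebra K B] {m : ℕ} (r : Fin m → B) (s : B)
    (h : ∀ (g : Fin m → B) (x : B), s * x + ∑ i, r i * g i = 0 → x = 0 ∧ ∀ i, g i = 0) :
    Function.Injective (FreeAlgebra.lift K r) := by
  rw [injective_iff_map_eq_zero]
  suffices H : ∀ (w : FreeMonoid (Fin m)) (P : FreeAlgebra K (Fin m)),
      FreeAlgebra.lift K r P * s = 0 →
        (FreeAlgebra.equivMonoidAlgebraFreeMonoid P).coeff w = 0 by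
    intro P hP
    refine FreeAlgebra.equivMonoidAlgebraFreeMonoid.injective ?_
    ext w
    simpa using H w P (by rw [hP, zero_mul])
  intro w
  induction w using FreeMonoid.recOn with
  | one =>
    intro P hP
    obtain ⟨c, Q, rfl⟩ := exists_eq_algebraMap_add_sum P
    have := (h (fun i => FreeAlgebra.lift K r (Q i) * s) (algebraMap K B c) (by
      rw [← hP]
      simp [add_mul, Finset.sum_mul, mul_assoc, Algebra.commutes])).1
    have hc : c = 0 := by simpa using this
    simp [hc, FreeAlgebra.equivMonoidAlgebraFreeMonoid, MonoidAlgebra.coeff_sum]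
  | of_mul j w ih =>
    intro P hP
    obtain ⟨c, Q, rfl⟩ := exists_eq_algebraMap_add_sum P
    obtain ⟨hc, hQ⟩ := h (fun i => FreeAlgebra.lift K r (Q i) * s) (algebraMap K B c) (by
      rw [← hP]
      simp [add_mul, Finset.sum_mul, mul_assoc, Algebra.commutes])
    have hc : c = 0 := by simpa using hc
    have := ih (Q j) (hQ j)
    subst hc
    simp only [map_zero, zero_add, map_sum, map_mul, MonoidAlgebra.coeff_sum,
      Finsupp.finsetSum_apply]
    refine Finset.sum_eq_zero fun i _ => ?_
    have hi : FreeAlgebra.equivMonoidAlgebraFreeMonoid (FreeAlgebra.ι K i) =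
      MonoidAlgebra.single (FreeMonoid.of i) 1 := by
        simp [FreeAlgebra.equivMonoidAlgebraFreeMonoid]
    rw [hi]
    by_cases hij : i = j
    · subst hij
      simp [MonoidAlgebra.coeff_single_mul_mul, this]
    · exact MonoidAlgebra.coeff_single_mul_of_forall_mul_ne _ _ fun d hd =>
        hij (List.cons.inj hd).1

end Independent

section Subalgebra

open MonoidAlgebra

variable {K α : Type*} [Field K] [LinearOrder α]

theorem rightIndependent_of_isLead {a b : MonoidAlgebra K (FreeMonoid α)} {p q : FreeMonoid α}
    (ha : IsLead a p) (hb : IsLead b q) (hpq : p.length = q.length) (hne : p ≠ q) :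
    RightIndependent a b := by
  have ha0 : a ≠ 0 := fun h => ha.1 (by simp [h])
  have hb0 : b ≠ 0 := fun h => hb.1 (by simp [h])
  intro x y h
  have hy : y = 0 := by
    by_contra hy
    have hx : x ≠ 0 := by
      rintro rfl
      simp [hb0, hy] at h
    obtain ⟨s, hs⟩ := exists_isLead (neg_ne_zero.2 hx)
    obtain ⟨t, ht⟩ := exists_isLead hy
    have h1 := ha.mul hs
    rw [mul_neg, neg_eq_of_add_eq_zero_right h] at h1
    exact hne (eq_of_mul_eq_mul (h1.unique (hb.mul ht)) hpq)
  subst hy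
  simpa [ha0] using h

variable {S : Subalgebra K (MonoidAlgebra K (FreeMonoid α))}

/-- If the leading words of a subalgebra commute, those of equal length coincide. -/
theorem IsLead.eq_of_length_eq
    (hS : ∀ f ∈ S, ∀ g ∈ S, ∀ p q, IsLead f p → IsLead g q → p * q = q * p)
    {f g : MonoidAlgebra K (FreeMonoid α)} {p q : FreeMonoid α} (hf : f ∈ S) (hg : g ∈ S)
    (hp : IsLead f p) (hq : IsLead g q) (h : p.length = q.length) : p = q :=
  eq_of_mul_eq_mul (hS f hf g hg p q hp hq) h

/-- An element `a` satisfying `hgood` is central in `S`: if `f` did not commute with `a`, a suitable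
`f ^ k - c • a ^ l` would have the same commutator with `a` as `f ^ k` but a shorter leading word,
so the bounded quantity `deg (a * f - f * a) - deg f` could be increased indefinitely. -/
theorem commute_of_cast_div_gcd_ne_zero
    (hS : ∀ f ∈ S, ∀ g ∈ S, ∀ p q, IsLead f p → IsLead g q → p * q = q * p)
    {a : MonoidAlgebra K (FreeMonoid α)} {w : FreeMonoid α} (ha : a ∈ S) (hw : IsLead a w)
    (hgood : ∀ f ∈ S, ∀ p, IsLead f p →
      ((w.length / Nat.gcd w.length p.length : ℕ) : K) ≠ 0) :
    ∀ f ∈ S, a * f = f * a := by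
  suffices H : ∀ (N : ℕ), ∀ f ∈ S, ∀ p q, IsLead f p → IsLead (a * f - f * a) q →
      w.length + p.length < q.length + N → False by
    intro f hf
    by_contra hne
    have hf0 : f ≠ 0 := by rintro rfl; simp at hne
    obtain ⟨p, hp⟩ := exists_isLead hf0
    obtain ⟨q, hq⟩ := exists_isLead (sub_ne_zero.2 hne)
    exact H (w.length + p.length + 1) f hf p q hp hq (by lia)
  intro N
  induction N with
  | zero =>
    intro f hf p q hp hq hlt
    have h1 := hp.2.mul hw.2
    rw [hS f hf a ha p w hp hw] at h1
    have := length_le_of_le (((hw.2.mul hp.2).sub h1) _ hq.1)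
    rw [FreeMonoid.length_mul] at this
    lia
  | succ N ih =>
    intro f hf p q hp hq hlt
    have hk := hgood f hf p hp
    set k := w.length / Nat.gcd w.length p.length with hkdef
    set l := p.length / Nat.gcd w.length p.length with hldef
    have hkl : k * p.length = l * w.length := by
      rw [hkdef, hldef, Nat.div_mul_right_comm (Nat.gcd_dvd_left _ _),
        Nat.div_mul_right_comm (Nat.gcd_dvd_right _ _), mul_comm]
    obtain ⟨j, hj⟩ : ∃ j, k = j + 1 := Nat.exists_eq_succ_of_ne_zero (by rintro h; simp [h] at hk)
    have hdS : a * f - f * a ∈ S := S.sub_mem (S.mul_mem ha hf) (S.mul_mem hf ha)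
    obtain ⟨hb, hc⟩ := isBound_commutator_pow hp.2 hq.2 (hS f hf _ hdS p q hp hq) j
    rw [← hj] at hb hc
    have hD : IsLead (a * f ^ k - f ^ k * a) (p ^ j * q) :=
      ⟨hc ▸ mul_ne_zero hk (mul_ne_zero (pow_ne_zero _ hp.1) hq.1), hb⟩
    have hfk : f ^ k ∈ S := S.pow_mem hf k
    have hal : a ^ l ∈ S := S.pow_mem ha l
    have hpw : w ^ l = p ^ k := IsLead.eq_of_length_eq hS hal hfk (hw.pow l) (hp.pow k)
      (by rw [length_pow, length_pow, hkl])
    have hlal := hw.pow l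
    rw [hpw] at hlal
    set c := (f ^ k).coeff (p ^ k) / (a ^ l).coeff (p ^ k)
    have hfS : f ^ k - c • a ^ l ∈ S := S.sub_mem hfk (S.smul_mem hal c)
    have hDf : a * (f ^ k - c • a ^ l) - (f ^ k - c • a ^ l) * a = a * f ^ k - f ^ k * a := by
      simp only [mul_sub, sub_mul, mul_smul_comm, smul_mul_assoc, ← pow_succ, ← pow_succ']
      abel
    rw [← hDf] at hD
    have hne : f ^ k - c • a ^ l ≠ 0 := by
      intro h
      rw [h] at hD
      exact hD.1 (by simp)
    obtain ⟨p', hp'⟩ := exists_isLead hne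
    have hlt' := (hp.pow k).lt_of_cancel hlal hp'
    have hlen : p'.length < k * p.length := by
      rw [← length_pow]
      exact (length_le_of_le hlt'.le).lt_of_ne fun h =>
        hlt'.ne (IsLead.eq_of_length_eq hS hfS hfk hp' (hp.pow k) h)
    refine ih _ hfS _ _ hp' hD ?_
    rw [FreeMonoid.length_mul, length_pow]
    rw [hj, add_mul, one_mul] at hlen
    lia

/-- The leading word of a noncentral element is nonempty. -/
theorem exists_isLead_length_ne_zero
    {u v : MonoidAlgebra K (FreeMonoid α)} (huv : u * v ≠ v * u) :
    ∃ p, IsLead u p ∧ p.length ≠ 0 := by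
  have hu0 : u ≠ 0 := by rintro rfl; simp at huv
  obtain ⟨p, hp⟩ := exists_isLead hu0
  refine ⟨p, hp, fun h => huv ?_⟩
  have hu : u = algebraMap K _ (u.coeff 1) := by
    ext q
    by_cases hq : q = 1
    · simp [hq]
    · have : u.coeff q = 0 := by
        by_contra h'
        have := length_le_of_le (hp.2 q h')
        exact hq (FreeMonoid.length_eq_zero.1 (by lia))
      simp [this, hq]
  rw [hu, Algebra.commutes]

/-- A subalgebra whose leading words commute is commutative. -/
theorem commute_of_leading_words_commute
    (hS : ∀ f ∈ S, ∀ g ∈ S, ∀ p q, IsLead f p → IsLead g q → p * q = q * p)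
    {u v : MonoidAlgebra K (FreeMonoid α)} (hu : u ∈ S) (hv : v ∈ S) : u * v = v * u := by
  classical
  by_contra huv
  obtain ⟨p₀, hp₀, hlen⟩ := exists_isLead_length_ne_zero huv
  obtain ⟨P, hP⟩ := CharP.exists K
  have hP1 : P ≠ 1 := CharP.char_ne_one K P
  have hex : ∃ e, ∃ f ∈ S, ∃ p, IsLead f p ∧ ¬ P ^ (e + 1) ∣ p.length := by
    refine ⟨p₀.length, u, hu, p₀, hp₀, fun h => ?_⟩
    rcases Nat.lt_or_ge P 2 with h2 | h2
    · obtain rfl : P = 0 := by lia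
      simp [hlen] at h
    · have := Nat.le_of_dvd (Nat.pos_of_ne_zero hlen) h
      have := Nat.lt_pow_self h2 (n := p₀.length + 1)
      lia
  set e := Nat.find hex with he
  have hdvd : ∀ f ∈ S, ∀ p, IsLead f p → P ^ e ∣ p.length := by
    intro f hf p hp
    rcases Nat.eq_zero_or_eq_succ_pred e with h0 | h0
    · simp [h0]
    · by_contra h
      rw [h0] at h
      have := Nat.find_min hex (m := e.pred) (by lia)
      exact this ⟨f, hf, p, hp, h⟩
  have central : ∀ a ∈ S, ∀ w, IsLead a w → ¬ P ^ (e + 1) ∣ w.length →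
      ∀ f ∈ S, a * f = f * a := by
    intro a ha w hw hdw
    refine commute_of_cast_div_gcd_ne_zero hS ha hw fun f hf p hp h => hdw ?_
    rw [CharP.cast_eq_zero_iff K P] at h
    rw [← Nat.mul_div_cancel' (Nat.gcd_dvd_left w.length p.length), pow_succ]
    exact mul_dvd_mul (Nat.dvd_gcd (hdvd a ha w hw) (hdvd f hf p hp)) h
  obtain ⟨a, ha, w, hw, hdw⟩ := Nat.find_spec hex
  have hac := central a ha w hw hdw
  by_cases hd : P ^ (e + 1) ∣ p₀.length
  · have hauc := central (a * u) (S.mul_mem ha hu) (w * p₀) (hw.mul hp₀)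
      (by rwa [FreeMonoid.length_mul, Nat.dvd_add_iff_left hd |>.symm]) v hv
    rw [← mul_assoc, ← hac v hv, mul_assoc, mul_assoc] at hauc
    exact huv (mul_left_cancel₀ (fun h => hw.1 (by simp [h])) hauc)
  · exact huv (central u hu p₀ hp₀ hd v hv)

/-- A noncommutative subalgebra of a free algebra contains two right independent elements. -/
theorem exists_rightIndependent {u v : MonoidAlgebra K (FreeMonoid α)} (hu : u ∈ S) (hv : v ∈ S)
    (huv : u * v ≠ v * u) : ∃ a ∈ S, ∃ b ∈ S, RightIndependent a b := by
  have hS := mt (fun hS => commute_of_leading_words_commute (S := S) hS hu hv) huv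
  push Not at hS
  obtain ⟨f, hf, g, hg, p, q, hp, hq, hpq⟩ := hS
  exact ⟨f * g, S.mul_mem hf hg, g * f, S.mul_mem hg hf,
    rightIndependent_of_isLead (hp.mul hq) (hq.mul hp)
      (by simp only [FreeMonoid.length_mul]; lia) hpq⟩

end Subalgebra

theorem adjoin_of_noncommuting_pair_has_no_identities
    (K : Type*) [Field K] (n : ℕ) (hn : 2 ≤ n)
    (u v : FreeAlgebra K (Fin n)) (huv : u * v ≠ v * u)
    (m : ℕ) (hm : 1 ≤ m) (P : FreeAlgebra K (Fin m)) (hP : P ≠ 0) :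
    ∃ r : Fin m → (Algebra.adjoin K ({u, v} : Set (FreeAlgebra K (Fin n)))),
      FreeAlgebra.lift K (fun i => (r i : FreeAlgebra K (Fin n))) P ≠ 0 := by
  set φ := FreeAlgebra.equivMonoidAlgebraFreeMonoid (R := K) (X := Fin n)
  set R := Algebra.adjoin K ({u, v} : Set (FreeAlgebra K (Fin n)))
  have hu : φ u ∈ R.map φ.toAlgHom := ⟨u, Algebra.subset_adjoin (by simp), rfl⟩
  have hv : φ v ∈ R.map φ.toAlgHom := ⟨v, Algebra.subset_adjoin (by simp), rfl⟩
  obtain ⟨_, ⟨a, ha, rfl⟩, _, ⟨b, hb, rfl⟩, hab⟩ := exists_rightIndependent hu hv fun h =>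
    huv (φ.injective (by rw [map_mul, map_mul, h]))
  have hab' : RightIndependent a b := fun x y h => by
    have := hab (φ x) (φ y) (by simpa using congrArg φ h)
    simpa using this
  refine ⟨fun i => ⟨b ^ (i : ℕ) * a, R.mul_mem (R.pow_mem hb _) ha⟩, fun h => hP ?_⟩
  exact (injective_iff_map_eq_zero _).1
    (lift_injective_of_rightIndependent _ (b ^ m) (hab'.pow_mul m)) P h

end Stmt10
end

section
/- Let 𝒞 be a small category and φ an equinumerous automorphism of 𝒞. Then there exist a stable automorphism φ_S and an inner automorphism φ_I of 𝒞 such that φ = φ_S ∘ φ_I. -/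
/-!
Statement 12: Let `𝒞` be a small category and `φ` an equinumerous automorphism of
`𝒞`. Then there exist a stable automorphism `φ_S` and an inner automorphism `φ_I`
of `𝒞` with `φ = φ_S ∘ φ_I`.
-/

namespace Stmt12

open CategoryTheory

/-- `F` is an automorphism of the category `C`: a functor bijective on objects and
morphisms, i.e. admitting a strict inverse functor. -/
def IsAut {C : Type*} [Category C] (F : C ⥤ C) : Prop :=
  ∃ G : C ⥤ C, F ⋙ G = Functor.id C ∧ G ⋙ F = Functor.id C

/-- Replacing the object map of the identity functor along isomorphisms `s D : D ≅ φ.obj D`,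
where `φ` is an automorphism, yields an automorphism. -/
theorem isAut_copyObj_id {C : Type*} [Category C] {φ : C ⥤ C} (hφ : IsAut φ)
    (s : ∀ D : C, D ≅ φ.obj D) :
    IsAut ((Functor.id C).copyObj φ.obj s) := by
  obtain ⟨G, h₁, h₂⟩ := hφ
  have hφG (X : C) : G.obj (φ.obj X) = X := Functor.congr_obj h₁ X
  have hGφ (X : C) : φ.obj (G.obj X) = X := Functor.congr_obj h₂ X
  have hs {X Y : C} (h : X = Y) :
      (s X).hom = eqToHom h ≫ (s Y).hom ≫ eqToHom (congrArg φ.obj h.symm) := by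
    subst h; simp
  have hs_inv {X Y : C} (h : X = Y) :
      (s X).inv = eqToHom (congrArg φ.obj h) ≫ (s Y).inv ≫ eqToHom h.symm := by
    subst h; simp
  refine ⟨(Functor.id C).copyObj G.obj
    fun X => eqToIso (hGφ X).symm ≪≫ (s (G.obj X)).symm, ?_, ?_⟩
  · refine CategoryTheory.Functor.ext hφG fun X Y f => ?_
    simp [Functor.copyObj, hs (hφG X), hs_inv (hφG Y)]
  · refine CategoryTheory.Functor.ext hGφ fun X Y f => ?_
    simp [Functor.copyObj]

theorem equinumerous_eq_stable_comp_inner {C : Type u} [SmallCategory C]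
    (φ : C ⥤ C) (hφ : IsAut φ) (heq : ∀ D : C, Nonempty (φ.obj D ≅ D)) :
    ∃ φS φI : C ⥤ C,
      IsAut φS ∧ (∀ D : C, φS.obj D = D) ∧
      IsAut φI ∧ Nonempty (φI ≅ Functor.id C) ∧
      φ = φI ⋙ φS := by
  obtain ⟨G, h₁, h₂⟩ := id hφ
  have s (D : C) : D ≅ φ.obj D := (heq D).some.symm
  let φI : C ⥤ C := (Functor.id C).copyObj φ.obj s
  have hI : IsAut φI := isAut_copyObj_id hφ _
  obtain ⟨J, hJ₁, hJ₂⟩ := id hI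
  have hJ (D : C) : φ.obj (J.obj D) = D := Functor.congr_obj hJ₂ D
  refine ⟨J ⋙ φ, φI, ⟨G ⋙ φI, ?_, ?_⟩, hJ, hI,
    ⟨((Functor.id C).isoCopyObj _ _).symm⟩, ?_⟩
  · rw [Functor.assoc, ← Functor.assoc φ, h₁, Functor.id_comp, hJ₂]
  · rw [Functor.assoc, ← Functor.assoc φI, hJ₁, Functor.id_comp, h₂]
  · rw [← Functor.assoc, hJ₁, Functor.id_comp]

end Stmt12
end
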